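/- Fix an integer k ≥ 3. There exists δ₀ > 0 depending only on k such that the following holds for every δ ∈ (0, δ₀] and every C^∞ function η : ℝ → [0,1] supported in [−δ, δ] and equal to 1 on [−δ/2, δ/2]. There exist a complex number C_sta and a constant C > 0 (depending only on k and η) such that for all distinct positive integers n, m, writing φ_{n,m}(x) = (n−m)(x − (n+m)x^k/k), x₀ = (n+m)^{−1/(k−1)}, θ_{n,m} = (k−1)(n−m)/(k(n+m)^{1/(k−1)}), and I(n,m) = ∫_ℝ e(φ_{n,m}(x)) η((n+m)^{1/(k−1)}(x − x₀)) dx, one has: (i) if m < n and n − m ≥ (n+m)^{1/(k−1)}, then |I(n,m) − conj(C_sta) e(θ_{n,m}) |n−m|^{−1/2} (n+m)^{−1/(2(k−1))}| ≤ C/|n−m|; (ii) if m > n and m − n ≥ (n+m)^{1/(k−1)}, then |I(n,m) − C_sta e(θ_{n,m}) |n−m|^{−1/2} (n+m)^{−1/(2(k−1))}| ≤ C/|n−m|; (iii) if |n−m| ≤ (n+m)^{1/(k−1)}, then |I(n,m)| ≤ C (n+m)^{−1/(k−1)}. -/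

import Mathlib

open MeasureTheory

/-- `e z = e^{2πiz}`. -/
noncomputable def e (t : ℝ) : ℂ := Complex.exp (2 * Real.pi * Complex.I * t)

lemma norm_e (t : ℝ) : ‖e t‖ = 1 := by
  have h : e t = Complex.exp (((2 * Real.pi * t : ℝ) : ℂ) * Complex.I) := by
    unfold e
    congr 1
    push_cast
    ring
  rw [h, Complex.norm_exp_ofReal_mul_I]

lemma e_add (s t : ℝ) : e (s + t) = e s * e t := by
  simp only [e, ← Complex.exp_add]
  push_cast
  ring_nf

lemma conj_e (t : ℝ) : (starRingEnd ℂ) (e t) = e (-t) := by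
  simp only [e, ← Complex.exp_conj]
  simp [map_ofNat]

lemma hasDerivAt_e (t : ℝ) : HasDerivAt e (2 * Real.pi * Complex.I * e t) t := by
  have h := ((Complex.ofRealCLM.hasDerivAt (x := t)).const_mul
    (2 * Real.pi * Complex.I : ℂ)).cexp
  refine h.congr_deriv ?_
  simp only [e, Complex.ofRealCLM_apply, Complex.ofReal_one]
  ring

lemma continuous_e : Continuous e :=
  continuous_iff_continuousAt.2 fun t => (hasDerivAt_e t).continuousAt

lemma integrable_e_mul {f φ : ℝ → ℝ} (hf : Continuous f) (hφ : Continuous φ)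
    (hc : HasCompactSupport φ) (l : ℝ) :
    Integrable (fun u => e (l * f u) * (φ u : ℂ)) := by
  apply Continuous.integrable_of_hasCompactSupport
  · exact (continuous_e.comp (by fun_prop)).mul (by fun_prop)
  · exact (hc.comp_left (g := ((↑) : ℝ → ℂ)) Complex.ofReal_zero).mul_left

/-- Integration by parts against an oscillating factor. -/
lemma integral_e_mul_deriv_mul {f φ : ℝ → ℝ} (hf : ContDiff ℝ 1 f) (hφ : ContDiff ℝ 1 φ)
    (hc : HasCompactSupport φ) (l : ℝ) :
    2 * Real.pi * Complex.I * l * ∫ u, e (l * f u) * ((deriv f u * φ u : ℝ) : ℂ) =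
      -∫ u, e (l * f u) * ((deriv φ u : ℝ) : ℂ) := by
  have hf' := hf.continuous_deriv le_rfl
  have hφ' := hφ.continuous_deriv le_rfl
  have h1 : ∀ u, HasDerivAt (fun u => e (l * f u))
      (2 * Real.pi * Complex.I * l * ((deriv f u : ℝ) : ℂ) * e (l * f u)) u := fun u => by
    have h := (hasDerivAt_e (l * f u)).scomp u
      (((hf.differentiable one_ne_zero) u).hasDerivAt.const_mul l)
    refine h.congr_deriv ?_
    simp only [Complex.real_smul]
    push_cast
    ring
  have h2 : ∀ u, HasDerivAt (fun u => (φ u : ℂ)) ((deriv φ u : ℝ) : ℂ) u := fun u =>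
    ((hφ.differentiable one_ne_zero) u).hasDerivAt.ofReal_comp
  have hi := integrable_e_mul (φ := fun u => deriv f u * φ u) hf.continuous
    (hf'.mul hφ.continuous) hc.mul_left l
  have h := integral_mul_deriv_eq_deriv_mul_of_integrable (fun u _ => h1 u) (fun u _ => h2 u)
    (integrable_e_mul hf.continuous hφ' hc.deriv l)
    ((hi.const_mul (2 * Real.pi * Complex.I * l)).congr
      (Filter.Eventually.of_forall fun u => by
        simp only [Pi.mul_apply]; push_cast; ring))
    (integrable_e_mul hf.continuous hφ.continuous hc l)
  rw [h, neg_neg, ← integral_const_mul]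
  congr 1
  ext u
  push_cast
  ring

lemma hasDerivAt_integral_e_mul {f η : ℝ → ℝ} (hf : Continuous f) (hη : Continuous η)
    (hc : HasCompactSupport η) (l : ℝ) :
    HasDerivAt (fun l => ∫ u, e (l * f u) * (η u : ℂ))
      (2 * Real.pi * Complex.I * ∫ u, e (l * f u) * ((f u * η u : ℝ) : ℂ)) l := by
  have hfη : Continuous fun u => f u * η u := hf.mul hη
  have h := hasDerivAt_integral_of_dominated_loc_of_deriv_le (μ := volume) (x₀ := l)
    (s := Set.univ) (F := fun l u => e (l * f u) * (η u : ℂ))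
    (F' := fun l u => 2 * Real.pi * Complex.I * (e (l * f u) * ((f u * η u : ℝ) : ℂ)))
    (bound := fun u => 2 * Real.pi * |f u * η u|) Filter.univ_mem
    (Filter.Eventually.of_forall fun x =>
      (integrable_e_mul hf hη hc x).aestronglyMeasurable)
    (integrable_e_mul hf hη hc l)
    ((integrable_e_mul hf hfη hc.mul_left l).const_mul _).aestronglyMeasurable
    (Filter.Eventually.of_forall fun u x _ => by
      rw [norm_mul, norm_mul (e _), norm_e, Complex.norm_real]
      simp [abs_of_pos Real.pi_pos])
    ((hfη.integrable_of_hasCompactSupport hc.mul_left).abs.const_mul _)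
    (Filter.Eventually.of_forall fun u x _ => by
      have h := ((hasDerivAt_e (x * f u)).scomp x
        ((hasDerivAt_id x).mul_const (f u))).mul_const (η u : ℂ)
      refine h.congr_deriv ?_
      simp only [Complex.real_smul]
      push_cast
      ring)
  rw [← integral_const_mul]
  exact h.2

/-- A function whose derivative is `O(t^(-3/2))` converges at infinity at rate `t^(-1/2)`. -/
lemma exists_limit_of_norm_deriv_le {H H' : ℝ → ℂ} {K : ℝ}
    (hH : ∀ t, 0 < t → HasDerivAt H (H' t) t)
    (hK : ∀ t, 0 < t → ‖H' t‖ ≤ K * t ^ (-(3 / 2) : ℝ)) :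
    ∃ c : ℂ, ∀ t, 0 < t → ‖H t - c‖ ≤ 2 * K * t ^ (-(1 / 2) : ℝ) := by
  have hrp : ∀ t : ℝ, 0 < t →
      IntegrableOn (fun x : ℝ => K * x ^ (-(3 / 2) : ℝ)) (Set.Ioi t) := fun t ht =>
    (integrableOn_Ioi_rpow_of_lt (by norm_num) ht).const_mul K
  have hint : ∀ t, 0 < t → IntegrableOn H' (Set.Ioi t) := fun t ht => by
    have hd : IntegrableOn (deriv H) (Set.Ioi t) := by
      refine (hrp t ht).mono' (stronglyMeasurable_deriv H).aestronglyMeasurable ?_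
      refine (ae_restrict_iff' measurableSet_Ioi).2 (Filter.Eventually.of_forall fun x hx => ?_)
      rw [(hH x (ht.trans hx)).deriv]
      exact hK x (ht.trans hx)
    exact hd.congr_fun (fun x hx => (hH x (ht.trans hx)).deriv) measurableSet_Ioi
  have hlim := tendsto_limUnder_of_hasDerivAt_of_integrableOn_Ioi
    (fun x hx => hH x (zero_lt_one.trans hx)) (hint 1 one_pos)
  refine ⟨Filter.atTop.limUnder H, fun t ht => ?_⟩
  rw [norm_sub_rev, ← integral_Ioi_of_hasDerivAt_of_tendsto (hH t ht).continuousAt.continuousWithinAt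
    (fun x hx => hH x (ht.trans hx)) (hint t ht) hlim]
  refine (norm_integral_le_of_norm_le (hrp t ht) ((ae_restrict_iff' measurableSet_Ioi).2
    (Filter.Eventually.of_forall fun x hx => hK x (ht.trans hx)))).trans (le_of_eq ?_)
  rw [integral_const_mul, integral_Ioi_rpow_of_lt (by norm_num) ht]
  norm_num
  ring

/-- Stationary phase with error `O(1/l)`: the divisibility hypotheses encode that `f` vanishes
to second order, nondegenerately, at its only critical point in the support of `η`. -/
lemma stationary_phase {f η φ₁ φ₂ : ℝ → ℝ} (hf : ContDiff ℝ 1 f) (hη : Continuous η)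
    (hcη : HasCompactSupport η) (hφ₁ : ContDiff ℝ 1 φ₁) (hc₁ : HasCompactSupport φ₁)
    (hφ₂ : ContDiff ℝ 1 φ₂) (hc₂ : HasCompactSupport φ₂)
    (h₁ : ∀ u, f u * η u = deriv f u * φ₁ u)
    (h₂ : ∀ u, deriv φ₁ u = η u / 2 - deriv f u * φ₂ u) :
    ∃ c : ℂ, ∃ C > 0, ∀ l : ℝ, 0 < l →
      ‖(∫ u, e (l * f u) * (η u : ℂ)) - c * ((l ^ (-(1 / 2) : ℝ) : ℝ) : ℂ)‖ ≤ C / l := by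
  set J : ℝ → ℂ := fun l => ∫ u, e (l * f u) * (η u : ℂ) with hJ
  set J' : ℝ → ℂ := fun l =>
    2 * Real.pi * Complex.I * ∫ u, e (l * f u) * ((f u * η u : ℝ) : ℂ) with hJ'
  set K : ℝ := ∫ u, |deriv φ₂ u| with hKdef
  have hK0 : 0 ≤ K := integral_nonneg fun u => abs_nonneg _
  have hf' := hf.continuous_deriv le_rfl
  have hode : ∀ l, 0 < l → ‖J l / 2 + l * J' l‖ ≤ K / l := fun l hl => by
    have e1 := integral_e_mul_deriv_mul hf hφ₁ hc₁ l
    have e2 := integral_e_mul_deriv_mul hf hφ₂ hc₂ l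
    have e3 : ∫ u, e (l * f u) * ((deriv φ₁ u : ℝ) : ℂ) =
        J l / 2 - ∫ u, e (l * f u) * ((deriv f u * φ₂ u : ℝ) : ℂ) := by
      rw [hJ, ← integral_div, ← integral_sub ((integrable_e_mul hf.continuous hη hcη l).div_const 2)
        (integrable_e_mul (φ := fun u => deriv f u * φ₂ u) hf.continuous
          (hf'.mul hφ₂.continuous) hc₂.mul_left l)]
      congr 1
      ext u
      rw [h₂]
      push_cast
      ring
    have e4 : J l / 2 + l * J' l = ∫ u, e (l * f u) * ((deriv f u * φ₂ u : ℝ) : ℂ) := by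
      simp only [hJ', h₁]
      rw [e3] at e1
      linear_combination e1
    have e5 : ‖∫ u, e (l * f u) * ((deriv φ₂ u : ℝ) : ℂ)‖ ≤ K := by
      refine (norm_integral_le_integral_norm _).trans (le_of_eq ?_)
      simp [norm_e, hKdef]
    rw [e4, le_div_iff₀ hl]
    have e6 := congrArg norm e2
    simp only [norm_mul, norm_neg, Complex.norm_I, Complex.norm_real, Real.norm_eq_abs,
      abs_of_pos Real.pi_pos, abs_of_pos hl, Complex.norm_ofNat, mul_one] at e6
    rw [← e6] at e5
    have h3 := Real.pi_gt_three
    nlinarith [mul_nonneg hl.le (norm_nonneg (∫ u, e (l * f u) * ((deriv f u * φ₂ u : ℝ) : ℂ)))]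
  have hH : ∀ t, 0 < t → HasDerivAt (fun t : ℝ => ((t ^ (1 / 2 : ℝ) : ℝ) : ℂ) * J t)
      (((t ^ (-(1 / 2) : ℝ) : ℝ) : ℂ) * (J t / 2 + t * J' t)) t := fun t ht => by
    have h := ((Real.hasDerivAt_rpow_const (p := 1 / 2) (Or.inl ht.ne')).ofReal_comp).mul
      (hasDerivAt_integral_e_mul hf.continuous hη hcη t)
    refine h.congr_deriv ?_
    simp only [hJ, hJ']
    have hr : t ^ (1 / 2 : ℝ) = t ^ (-(1 / 2) : ℝ) * t := by
      rw [← Real.rpow_add_one ht.ne']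
      norm_num
    rw [hr, show (1 / 2 - 1 : ℝ) = -(1 / 2) by norm_num]
    push_cast
    ring
  obtain ⟨c, hc⟩ := exists_limit_of_norm_deriv_le (K := K) hH fun t ht => by
    rw [norm_mul, Complex.norm_real, Real.norm_of_nonneg (Real.rpow_nonneg ht.le _)]
    refine (mul_le_mul_of_nonneg_left (hode t ht) (Real.rpow_nonneg ht.le _)).trans (le_of_eq ?_)
    rw [show (-(3 / 2) : ℝ) = -(1 / 2) - 1 by norm_num, Real.rpow_sub_one ht.ne']
    ring
  refine ⟨c, 2 * K + 1, by linarith, fun l hl => ?_⟩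
  have hmul : l ^ (-(1 / 2) : ℝ) * l ^ (1 / 2 : ℝ) = 1 := by
    rw [← Real.rpow_add hl]
    norm_num
  have hsq : l ^ (-(1 / 2) : ℝ) * l ^ (-(1 / 2) : ℝ) = 1 / l := by
    rw [← Real.rpow_add hl, show (-(1 / 2) + -(1 / 2) : ℝ) = -1 by norm_num, Real.rpow_neg_one,
      one_div]
  have heq : J l - c * ((l ^ (-(1 / 2) : ℝ) : ℝ) : ℂ) = ((l ^ (-(1 / 2) : ℝ) : ℝ) : ℂ) *
      (((l ^ (1 / 2 : ℝ) : ℝ) : ℂ) * J l - c) := by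
    have := congrArg (fun x : ℝ => (x : ℂ)) hmul
    push_cast at this
    linear_combination (-J l) * this
  rw [heq, norm_mul, Complex.norm_real, Real.norm_of_nonneg (Real.rpow_nonneg hl.le _)]
  calc l ^ (-(1 / 2) : ℝ) * ‖((l ^ (1 / 2 : ℝ) : ℝ) : ℂ) * J l - c‖
      ≤ l ^ (-(1 / 2) : ℝ) * (2 * K * l ^ (-(1 / 2) : ℝ)) :=
        mul_le_mul_of_nonneg_left (hc l hl) (Real.rpow_nonneg hl.le _)
    _ = 2 * K * (l ^ (-(1 / 2) : ℝ) * l ^ (-(1 / 2) : ℝ)) := by ring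
    _ = 2 * K / l := by rw [hsq]; ring
    _ ≤ (2 * K + 1) / l := by gcongr; linarith

open Polynomial in
/-- The phase `((1 + u)^k - 1) / k - u` has a double zero at `0`, and its derivative has no other
zero in `(-1, ∞)`. -/
lemma exists_phase_factorization {k : ℕ} (hk : 2 ≤ k) :
    ∃ h : ℝ[X], (∀ u : ℝ, ((1 + u) ^ k - 1) / k - u = u ^ 2 * h.eval u) ∧
      ∀ u : ℝ, -1 < u → 0 < 2 * h.eval u + u * (derivative h).eval u := by
  have hk0 : (k : ℝ) ≠ 0 := by positivity
  obtain ⟨Q, hQ⟩ : (X : ℝ[X]) ∣ C (1 / (k : ℝ)) * ((1 + X) ^ k - 1) - X := by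
    rw [X_dvd_iff, coeff_zero_eq_eval_zero]
    simp
  have hd := congrArg derivative hQ
  simp only [derivative_sub, derivative_mul, derivative_C, derivative_X, derivative_one,
    derivative_pow, derivative_add] at hd
  have hk' : C (1 / (k : ℝ)) * C (k : ℝ) = 1 := by
    rw [← C_mul, one_div_mul_cancel hk0, C_1]
  have hd' : ((1 + X) ^ (k - 1) - 1 : ℝ[X]) = Q + X * derivative Q := by
    linear_combination hd - ((1 + X) ^ (k - 1)) * hk'
  obtain ⟨h, rfl⟩ : (X : ℝ[X]) ∣ Q := by
    rw [X_dvd_iff, coeff_zero_eq_eval_zero]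
    have := congrArg (eval 0) hd'
    simpa using this.symm
  refine ⟨h, fun u => ?_, fun u hu => ?_⟩
  · have := congrArg (eval u) hQ
    simp at this
    linear_combination this
  · have hg := geom_sum_mul (1 + X : ℝ[X]) (k - 1)
    rw [hd', add_sub_cancel_left, derivative_mul, derivative_X] at hg
    have hg' : ∑ i ∈ Finset.range (k - 1), (1 + X : ℝ[X]) ^ i = 2 * h + X * derivative h := by
      apply mul_right_cancel₀ (X_ne_zero (R := ℝ))
      rw [hg]
      ring
    have := congrArg (eval u) hg'
    simp only [eval_finsetSum, eval_pow, eval_add, eval_one, eval_X, eval_mul, eval_ofNat] at this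
    rw [← this]
    exact Finset.sum_pos (fun i _ => pow_pos (by linarith) i) ⟨0, by simp; omega⟩

lemma contDiff_div_of_support {n : ℕ∞} {φ p : ℝ → ℝ} (hφ : ContDiff ℝ n φ) (hp : ContDiff ℝ n p)
    (h : ∀ u ∈ tsupport φ, p u ≠ 0) : ContDiff ℝ n fun u => φ u / p u := by
  refine contDiff_iff_contDiffAt.2 fun u => ?_
  by_cases hu : u ∈ tsupport φ
  · exact hφ.contDiffAt.div hp.contDiffAt (h u hu)
  · refine contDiffAt_const (c := (0 : ℝ)) |>.congr_of_eventuallyEq ?_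
    filter_upwards [notMem_tsupport_iff_eventuallyEq.1 hu] with x hx
    simp [hx]

open Polynomial in
lemma stationary_phase_pow {k : ℕ} (hk : 2 ≤ k) {η : ℝ → ℝ} (hη : ContDiff ℝ (⊤ : ℕ∞) η)
    (hc : HasCompactSupport η) (hs : ∀ u ∈ tsupport η, -1 < u) :
    ∃ c : ℂ, ∃ C > 0, ∀ l : ℝ, 0 < l →
      ‖(∫ u, e (l * (((1 + u) ^ k - 1) / k - u)) * (η u : ℂ)) -
        c * ((l ^ (-(1 / 2) : ℝ) : ℝ) : ℂ)‖ ≤ C / l := by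
  obtain ⟨h, hfac, hpos⟩ := exists_phase_factorization hk
  set p : ℝ → ℝ := fun u => 2 * h.eval u + u * (derivative h).eval u with hp
  have hh : ContDiff ℝ (⊤ : ℕ∞) fun u : ℝ => h.eval u := h.contDiff_aeval _
  have hh' : ContDiff ℝ (⊤ : ℕ∞) fun u : ℝ => (derivative h).eval u := (derivative h).contDiff_aeval _
  have hpc : ContDiff ℝ (⊤ : ℕ∞) p := (contDiff_const.mul hh).add (contDiff_id.mul hh')
  set ζ : ℝ → ℝ := fun u => η u / p u with hζ
  have hζc : ContDiff ℝ (⊤ : ℕ∞) ζ :=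
    contDiff_div_of_support hη hpc fun u hu => (hpos u (hs u hu)).ne'
  have hcζ : HasCompactSupport ζ := by
    simp only [hζ, div_eq_mul_inv]
    exact hc.mul_right
  have hpζ : ∀ u, p u * ζ u = η u := fun u => by
    by_cases hu : u ∈ tsupport η
    · exact mul_div_cancel₀ _ (hpos u (hs u hu)).ne'
    · simp [hζ, image_eq_zero_of_notMem_tsupport hu]
  set χ : ℝ → ℝ := fun u => h.eval u * ζ u with hχ
  have hχc : ContDiff ℝ (⊤ : ℕ∞) χ := hh.mul hζc
  have hcχ : HasCompactSupport χ := hcζ.mul_left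
  set γ : ℝ → ℝ := fun u => (derivative h).eval u / 2 * ζ u - deriv χ u with hγ
  have hγc : ContDiff ℝ (⊤ : ℕ∞) γ :=
    ((hh'.div_const 2).mul hζc).sub (contDiff_infty_iff_deriv.1 hχc).2
  have hcγ : HasCompactSupport γ := hcζ.mul_left.sub hcχ.deriv
  have hγs : tsupport γ ⊆ tsupport η := by
    refine closure_minimal (fun u hu => ?_) (isClosed_tsupport η)
    by_contra hu'
    have hη0 := notMem_tsupport_iff_eventuallyEq.1 hu'
    have hχ0 : χ =ᶠ[nhds u] fun _ => 0 := by
      filter_upwards [hη0] with x hx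
      simp [hχ, hζ, hx]
    exact hu (by simp [hγ, hζ, hη0.eq_of_nhds, hχ0.deriv_eq])
  have hφ₂c : ContDiff ℝ (⊤ : ℕ∞) fun u => γ u / p u :=
    contDiff_div_of_support hγc hpc fun u hu => (hpos u (hs u (hγs hu))).ne'
  have hpγ : ∀ u, p u * (γ u / p u) = γ u := fun u => by
    by_cases hu : u ∈ tsupport γ
    · exact mul_div_cancel₀ _ (hpos u (hs u (hγs hu))).ne'
    · simp [image_eq_zero_of_notMem_tsupport hu]
  have hderiv : ∀ u, deriv (fun u : ℝ => u ^ 2 * h.eval u) u = u * p u := fun u => by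
    rw [((hasDerivAt_pow 2 u).fun_mul (h.hasDerivAt u)).deriv]
    simp only [hp]
    push_cast
    ring
  have hle : (1 : WithTop ℕ∞) ≤ ((⊤ : ℕ∞) : WithTop ℕ∞) := by exact_mod_cast le_top
  simp only [hfac]
  refine stationary_phase (φ₁ := fun u => u * χ u) (φ₂ := fun u => γ u / p u)
    (((contDiff_id.pow 2).mul hh).of_le hle) hη.continuous hc ((contDiff_id.mul hχc).of_le hle)
    hcχ.mul_left (hφ₂c.of_le hle) ?_ (fun u => ?_) (fun u => ?_)
  · simp only [div_eq_mul_inv]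
    exact hcγ.mul_right
  · rw [hderiv, ← hpζ]
    simp only [hχ]
    ring
  · rw [hderiv, mul_assoc, hpγ, ← hpζ, ((hasDerivAt_id' u).fun_mul
      ((hχc.differentiable (by simp)) u).hasDerivAt).deriv]
    simp only [hγ, hχ, hp]
    ring

/-- Rescaling by `s = (n + m) ^ (1 / (k - 1))` reduces the integral to one with a fixed phase. -/
lemma integral_rescale {k : ℕ} (hk : 2 ≤ k) {s : ℝ} (hs : 0 < s) (d : ℝ) (η : ℝ → ℝ) :
    ∫ x : ℝ, e (d * (x - s ^ (k - 1) * x ^ k / k)) * (η (s * (x - s⁻¹)) : ℂ) =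
      (s : ℂ)⁻¹ * (e ((k - 1) * d / (k * s)) *
        ∫ u, e (-(d / s) * (((1 + u) ^ k - 1) / k - u)) * (η u : ℂ)) := by
  have hk0 : (k : ℝ) ≠ 0 := by positivity
  set Ψ : ℝ → ℂ := fun u => e ((k - 1) * d / (k * s)) *
    (e (-(d / s) * (((1 + u) ^ k - 1) / k - u)) * (η u : ℂ)) with hΨ
  have h1 : ∀ x : ℝ, e (d * (x - s ^ (k - 1) * x ^ k / k)) * (η (s * (x - s⁻¹)) : ℂ) =
      Ψ (s * (x - s⁻¹)) := fun x => by
    simp only [hΨ]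
    rw [← mul_assoc, ← e_add]
    congr 2
    have h2 : 1 + s * (x - s⁻¹) = s * x := by
      field_simp
      ring
    have h3 : s ^ k = s ^ (k - 1) * s := by
      rw [← pow_succ, Nat.sub_add_cancel (by omega)]
    rw [h2, mul_pow, h3]
    field_simp
    ring
  simp only [h1]
  rw [integral_sub_right_eq_self (fun y => Ψ (s * y)) s⁻¹, Measure.integral_comp_mul_left,
    abs_of_pos (inv_pos.2 hs), hΨ, integral_const_mul, Complex.real_smul, Complex.ofReal_inv]

lemma norm_integral_e_mul_le {φ η : ℝ → ℝ} (h0 : ∀ u, 0 ≤ η u) :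
    ‖∫ u, e (φ u) * (η u : ℂ)‖ ≤ ∫ u, η u := by
  refine (norm_integral_le_integral_norm _).trans (le_of_eq ?_)
  simp [norm_e, abs_of_nonneg, h0]

/-- Error transfer from the rescaled integral. -/
lemma norm_rescaled_sub_le {s D C : ℝ} (hs : 0 < s) (hD : 0 < D) {θ : ℝ} {J c : ℂ}
    (h : ‖J - c * (((D / s) ^ (-(1 / 2) : ℝ) : ℝ) : ℂ)‖ ≤ C / (D / s)) :
    ‖(s : ℂ)⁻¹ * (e θ * J) -
      c * e θ * ((D ^ (-(1 / 2) : ℝ) * s ^ (-(1 / 2) : ℝ) : ℝ) : ℂ)‖ ≤ C / D := by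
  have h1 : D ^ (-(1 / 2) : ℝ) * s ^ (-(1 / 2) : ℝ) = s⁻¹ * (D / s) ^ (-(1 / 2) : ℝ) := by
    have h2 : s ^ (-(1 / 2) : ℝ) * s ^ (-(1 / 2) : ℝ) = s⁻¹ := by
      rw [← Real.rpow_add hs, ← Real.rpow_neg_one]
      norm_num
    have h3 := (Real.rpow_pos_of_pos hs (-(1 / 2))).ne'
    rw [Real.div_rpow hD.le hs.le, ← h2]
    field_simp
  rw [h1]
  have h2 : (s : ℂ)⁻¹ * (e θ * J) - c * e θ * ((s⁻¹ * (D / s) ^ (-(1 / 2) : ℝ) : ℝ) : ℂ) =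
      (s : ℂ)⁻¹ * e θ * (J - c * (((D / s) ^ (-(1 / 2) : ℝ) : ℝ) : ℂ)) := by
    push_cast
    ring
  rw [h2, norm_mul, norm_mul, norm_e, norm_inv, Complex.norm_real, Real.norm_of_nonneg hs.le,
    mul_one]
  calc s⁻¹ * _ ≤ s⁻¹ * (C / (D / s)) := mul_le_mul_of_nonneg_left h (inv_nonneg.2 hs.le)
    _ = C / D := by field_simp

/-- **Lemma (Stationary regime).** For `k ≥ 3` there is `δ₀ > 0` such that for every
`δ ∈ (0, δ₀]` and every smooth bump `η : ℝ → [0,1]` supported in `[−δ,δ]` and equal to `1`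
on `[−δ/2, δ/2]`, there exist `C_sta ∈ ℂ` and `C > 0` such that for all distinct positive
integers `n, m`, with `φ_{n,m}(x) = (n−m)(x − (n+m)xᵏ/k)`, `x₀ = (n+m)^{−1/(k−1)}`,
`θ_{n,m} = (k−1)(n−m)/(k(n+m)^{1/(k−1)})`, and
`I(n,m) = ∫ e(φ_{n,m}(x)) η((n+m)^{1/(k−1)}(x−x₀)) dx`, the three asymptotic estimates
(i), (ii), (iii) hold. -/
theorem stmt4 (k : ℕ) (hk : 3 ≤ k) :
    ∃ δ₀ > 0, ∀ δ : ℝ, 0 < δ → δ ≤ δ₀ →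
    ∀ η : ℝ → ℝ, ContDiff ℝ (⊤ : ℕ∞) η → (∀ x, η x ∈ Set.Icc (0:ℝ) 1) →
      Function.support η ⊆ Set.Icc (-δ) δ →
      (∀ x ∈ Set.Icc (-δ/2) (δ/2), η x = 1) →
    ∃ Csta : ℂ, ∃ C > 0, ∀ n m : ℕ, 0 < n → 0 < m → n ≠ m →
      let x₀ : ℝ := ((n:ℝ) + m) ^ (-(1 / ((k:ℝ) - 1)))
      let θ : ℝ := ((k:ℝ) - 1) * ((n:ℝ) - m) / (k * ((n:ℝ) + m) ^ (1 / ((k:ℝ) - 1)))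
      let I : ℂ := ∫ x : ℝ,
        e (((n:ℝ) - m) * (x - ((n:ℝ) + m) * x^k / k)) *
          (η (((n:ℝ) + m) ^ (1 / ((k:ℝ) - 1)) * (x - x₀)) : ℂ)
      ((m < n → ((n:ℝ) + m) ^ (1 / ((k:ℝ) - 1)) ≤ (n:ℝ) - m →
        ‖I - (starRingEnd ℂ) Csta * e θ *
            ((|(n:ℝ) - m| ^ (-(1/2 : ℝ)) * ((n:ℝ) + m) ^ (-(1 / (2 * ((k:ℝ) - 1)))) : ℝ) : ℂ)‖
          ≤ C / |(n:ℝ) - m|) ∧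
      (n < m → ((n:ℝ) + m) ^ (1 / ((k:ℝ) - 1)) ≤ (m:ℝ) - n →
        ‖I - Csta * e θ *
            ((|(n:ℝ) - m| ^ (-(1/2 : ℝ)) * ((n:ℝ) + m) ^ (-(1 / (2 * ((k:ℝ) - 1)))) : ℝ) : ℂ)‖
          ≤ C / |(n:ℝ) - m|) ∧
      (|(n:ℝ) - m| ≤ ((n:ℝ) + m) ^ (1 / ((k:ℝ) - 1)) →
        ‖I‖ ≤ C * ((n:ℝ) + m) ^ (-(1 / ((k:ℝ) - 1))))) := by
  refine ⟨1 / 4, by norm_num, fun δ hδ hδ' η hη h01 hsupp _ => ?_⟩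
  have hts : tsupport η ⊆ Set.Icc (-δ) δ := closure_minimal hsupp isClosed_Icc
  have hc : HasCompactSupport η := isCompact_Icc.of_isClosed_subset (isClosed_tsupport η) hts
  obtain ⟨c, C, hC, hJ⟩ := stationary_phase_pow (k := k) (by omega) hη hc
    fun u hu => by linarith [(hts hu).1]
  set K : ℝ := ∫ u, η u with hKdef
  have hK0 : 0 ≤ K := integral_nonneg fun u => (h01 u).1
  refine ⟨c, C + K, by linarith, fun n m hn hm _ => ?_⟩
  intro x₀ θ I
  have hN : (0 : ℝ) < (n : ℝ) + m := by positivity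
  have hk1 : (k : ℝ) - 1 ≠ 0 := by
    have : (3 : ℝ) ≤ k := by exact_mod_cast hk
    linarith
  set s : ℝ := ((n : ℝ) + m) ^ (1 / ((k : ℝ) - 1)) with hsdef
  have hs : 0 < s := Real.rpow_pos_of_pos hN _
  have hx₀ : x₀ = s⁻¹ := Real.rpow_neg hN.le _
  have hsN : (n : ℝ) + m = s ^ (k - 1) := by
    rw [hsdef, ← Real.rpow_natCast, ← Real.rpow_mul hN.le, Nat.cast_sub (by omega), Nat.cast_one,
      one_div_mul_cancel hk1, Real.rpow_one]
  have hsqrt : ((n : ℝ) + m) ^ (-(1 / (2 * ((k : ℝ) - 1)))) = s ^ (-(1 / 2) : ℝ) := by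
    rw [hsdef, ← Real.rpow_mul hN.le]
    congr 1
    field_simp
  have hI : I = (s : ℂ)⁻¹ * (e θ *
      ∫ u, e (-(((n : ℝ) - m) / s) * (((1 + u) ^ k - 1) / k - u)) * (η u : ℂ)) := by
    rw [← integral_rescale (by omega) hs, ← hsN, ← hx₀]
  have hsneg : ((n : ℝ) + m) ^ (-(1 / ((k : ℝ) - 1))) = s⁻¹ := hx₀
  refine ⟨fun hlt _ => ?_, fun hlt _ => ?_, fun _ => ?_⟩
  · have hD : (0 : ℝ) < (n : ℝ) - m := sub_pos.2 (by exact_mod_cast hlt)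
    rw [hsqrt, hI, abs_of_pos hD]
    refine (norm_rescaled_sub_le hs hD (C := C) ?_).trans (by gcongr; linarith)
    rw [← Complex.norm_conj, map_sub, map_mul, Complex.conj_conj, Complex.conj_ofReal,
      ← integral_conj]
    simp only [map_mul, conj_e, Complex.conj_ofReal, neg_mul, neg_neg]
    exact hJ _ (div_pos hD hs)
  · have hD : (n : ℝ) - m < 0 := sub_neg.2 (by exact_mod_cast hlt)
    rw [hsqrt, hI, abs_of_neg hD]
    refine (norm_rescaled_sub_le hs (neg_pos.2 hD) (C := C) ?_).trans
      (div_le_div_of_nonneg_right (by linarith) (neg_pos.2 hD).le)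
    rw [← neg_div]
    exact hJ _ (div_pos (neg_pos.2 hD) hs)
  · rw [hI, hsneg, norm_mul, norm_mul, norm_e, norm_inv, Complex.norm_real,
      Real.norm_of_nonneg hs.le, one_mul, mul_comm]
    refine mul_le_mul_of_nonneg_right ?_ (inv_nonneg.2 hs.le)
    exact (norm_integral_e_mul_le fun u => (h01 u).1).trans (by linarith)
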